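/- For every 0 < γ ≤ 1 there is a constant C = C(γ) such that for all v ∈ H^2(T^2): ‖v‖_{L^∞}^2 ≤ C ‖v‖_{L^2}^γ ‖∇v‖_{L^2}^{2-2γ} ‖∇²v‖_{L^2}^γ + C ‖v‖_{L^2}^2. -/

import Mathlib

open MeasureTheory

/-- Partial derivative of `f` at `x` in direction `e`. -/
noncomputable def pd (e : ℝ × ℝ) (f : ℝ × ℝ → ℝ) (x : ℝ × ℝ) : ℝ :=
  fderiv ℝ f x e

/-- The `L²` norm over the unit square. -/
noncomputable def l2Norm (f : ℝ × ℝ → ℝ) : ℝ :=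
  √(∫ x in Set.Icc (0 : ℝ × ℝ) 1, f x ^ 2)

lemma integrableOn_unitSquare {f : ℝ × ℝ → ℝ} (hf : Continuous f) :
    IntegrableOn f (Set.Icc (0 : ℝ × ℝ) 1) :=
  hf.continuousOn.integrableOn_compact isCompact_Icc

lemma unitSquare_eq_prod :
    Set.Icc (0 : ℝ × ℝ) 1 = Set.Icc (0 : ℝ) 1 ×ˢ Set.Icc (0 : ℝ) 1 := by
  rw [Set.Icc_prod_Icc]; rfl

lemma volume_unitSquare : volume.real (Set.Icc (0 : ℝ × ℝ) 1) = 1 := by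
  rw [unitSquare_eq_prod, Measure.real, Measure.volume_eq_prod, Measure.prod_prod]
  simp

lemma l2Norm_nonneg (f : ℝ × ℝ → ℝ) : 0 ≤ l2Norm f := Real.sqrt_nonneg _

lemma l2Norm_sq (f : ℝ × ℝ → ℝ) :
    l2Norm f ^ 2 = ∫ x in Set.Icc (0 : ℝ × ℝ) 1, f x ^ 2 :=
  Real.sq_sqrt (integral_nonneg fun _ => sq_nonneg _)

lemma integral_unitSquare {f : ℝ × ℝ → ℝ} (hf : Continuous f) :
    ∫ p in Set.Icc (0 : ℝ × ℝ) 1, f p = ∫ x in (0 : ℝ)..1, ∫ y in (0 : ℝ)..1, f (x, y) := by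
  have h := integrableOn_unitSquare hf
  rw [unitSquare_eq_prod] at h ⊢
  rw [Measure.volume_eq_prod] at h ⊢
  rw [setIntegral_prod _ h]
  simp only [intervalIntegral.integral_of_le zero_le_one, integral_Icc_eq_integral_Ioc]

lemma integral_unitSquare_swap {f : ℝ × ℝ → ℝ} (hf : Continuous f) :
    ∫ p in Set.Icc (0 : ℝ × ℝ) 1, f p = ∫ y in (0 : ℝ)..1, ∫ x in (0 : ℝ)..1, f (x, y) := by
  have h := integral_unitSquare (f := fun p => f p.swap) (by fun_prop)
  simp only [Prod.swap_prod_mk] at h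
  rw [← h, unitSquare_eq_prod, Measure.volume_eq_prod, setIntegral_prod_swap]

lemma sq_integral_mul_le {α : Type*} [MeasurableSpace α] {μ : Measure α} {f g : α → ℝ}
    (hf : Integrable (fun x => f x ^ 2) μ) (hg : Integrable (fun x => g x ^ 2) μ)
    (hfg : Integrable (fun x => f x * g x) μ) :
    (∫ x, f x * g x ∂μ) ^ 2 ≤ (∫ x, f x ^ 2 ∂μ) * ∫ x, g x ^ 2 ∂μ := by
  have key : ∀ t : ℝ, 0 ≤ (∫ x, g x ^ 2 ∂μ) * (t * t) + (2 * ∫ x, f x * g x ∂μ) * t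
      + ∫ x, f x ^ 2 ∂μ := by
    intro t
    have h : 0 ≤ ∫ x, (t * t) * g x ^ 2 + (2 * t) * (f x * g x) + f x ^ 2 ∂μ :=
      integral_nonneg fun x => by
        have : 0 ≤ (t * g x + f x) ^ 2 := sq_nonneg _
        simp only [Pi.zero_apply]
        linarith
    have i₁ : Integrable (fun x => (t * t) * g x ^ 2) μ := hg.const_mul _
    have i₂ : Integrable (fun x => (2 * t) * (f x * g x)) μ := hfg.const_mul _
    have i₃ : Integrable (fun x => (t * t) * g x ^ 2 + (2 * t) * (f x * g x)) μ := i₁.add i₂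
    rw [integral_add i₃ hf, integral_add i₁ i₂, integral_const_mul, integral_const_mul] at h
    linarith
  have := discrim_le_zero key
  rw [discrim] at this
  linarith

lemma integral_abs_mul_le {f g : ℝ × ℝ → ℝ} (hf : Continuous f) (hg : Continuous g) :
    ∫ x in Set.Icc (0 : ℝ × ℝ) 1, |f x * g x| ≤ l2Norm f * l2Norm g := by
  refine abs_le_of_sq_le_sq' ?_ (mul_nonneg (l2Norm_nonneg f) (l2Norm_nonneg g)) |>.2
  rw [mul_pow, l2Norm_sq, l2Norm_sq]
  have := sq_integral_mul_le (μ := volume.restrict (Set.Icc (0 : ℝ × ℝ) 1))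
    (f := fun x => |f x|) (g := fun x => |g x|) (integrableOn_unitSquare (by fun_prop))
    (integrableOn_unitSquare (by fun_prop)) (integrableOn_unitSquare (by fun_prop))
  simpa only [abs_mul, sq_abs] using this

lemma abs_sub_le_integral_abs_deriv {f f' : ℝ → ℝ} (hf : ∀ x, HasDerivAt f (f' x) x)
    (hf' : Continuous f') {x z : ℝ} (hx : x ∈ Set.Icc (0 : ℝ) 1) (hz : z ∈ Set.Icc (0 : ℝ) 1) :
    |f x - f z| ≤ ∫ s in (0 : ℝ)..1, |f' s| := by
  rw [← intervalIntegral.integral_eq_sub_of_hasDerivAt (fun s _ => hf s)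
    (hf'.intervalIntegrable z x)]
  refine (intervalIntegral.norm_integral_le_abs_integral_norm (f := f')).trans ?_
  simp only [Real.norm_eq_abs]
  refine intervalIntegral.abs_integral_mono_interval ?_ (ae_of_all _ fun _ => abs_nonneg _)
    (hf'.abs.intervalIntegrable _ _) |>.trans (abs_of_nonneg ?_).le
  · rw [Set.uIoc_of_le zero_le_one]
    intro t ht
    rw [Set.mem_uIoc] at ht
    rcases ht with ht | ht
    · exact ⟨hz.1.trans_lt ht.1, ht.2.trans hx.2⟩
    · exact ⟨hx.1.trans_lt ht.1, ht.2.trans hz.2⟩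
  · exact intervalIntegral.integral_nonneg zero_le_one fun _ _ => abs_nonneg _

lemma abs_le_integral_abs_add_abs_deriv {f f' : ℝ → ℝ} (hf : ∀ x, HasDerivAt f (f' x) x)
    (hf' : Continuous f') {x : ℝ} (hx : x ∈ Set.Icc (0 : ℝ) 1) :
    |f x| ≤ ∫ s in (0 : ℝ)..1, (|f s| + |f' s|) := by
  have hc : Continuous f := continuous_iff_continuousAt.2 fun x => (hf x).continuousAt
  have h : ∫ _ in (0 : ℝ)..1, |f x| ≤ ∫ s in (0 : ℝ)..1, (|f s| + ∫ t in (0 : ℝ)..1, |f' t|) := by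
    refine intervalIntegral.integral_mono_on zero_le_one (by simp)
      (Continuous.intervalIntegrable (by fun_prop) _ _) fun s hs => ?_
    have h₁ := abs_sub_le_integral_abs_deriv hf hf' hx hs
    have h₂ := abs_sub_abs_le_abs_sub (f x) (f s)
    linarith
  rw [intervalIntegral.integral_add (hc.abs.intervalIntegrable _ _) (by simp)] at h
  rw [intervalIntegral.integral_add (hc.abs.intervalIntegrable _ _)
    (hf'.abs.intervalIntegrable _ _)]
  simpa using h

lemma hasDerivAt_fst {f : ℝ × ℝ → ℝ} (hf : ContDiff ℝ 1 f) (x y : ℝ) :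
    HasDerivAt (fun s => f (s, y)) (pd (1, 0) f (x, y)) x :=
  ((hf.differentiable one_ne_zero) (x, y)).hasFDerivAt.comp_hasDerivAt x
    ((hasDerivAt_id x).prodMk (hasDerivAt_const x y))

lemma hasDerivAt_snd {f : ℝ × ℝ → ℝ} (hf : ContDiff ℝ 1 f) (x y : ℝ) :
    HasDerivAt (fun t => f (x, t)) (pd (0, 1) f (x, y)) y :=
  ((hf.differentiable one_ne_zero) (x, y)).hasFDerivAt.comp_hasDerivAt y
    ((hasDerivAt_const y x).prodMk (hasDerivAt_id y))

lemma continuous_pd {f : ℝ × ℝ → ℝ} (hf : ContDiff ℝ 1 f) (e : ℝ × ℝ) : Continuous (pd e f) :=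
  (hf.continuous_fderiv one_ne_zero).clm_apply continuous_const

lemma contDiff_pd {f : ℝ × ℝ → ℝ} (hf : ContDiff ℝ 2 f) (e : ℝ × ℝ) :
    ContDiff ℝ 1 (pd e f) :=
  (hf.fderiv_right (m := 1) (by norm_num)).clm_apply contDiff_const

lemma abs_le_integral_fst {w : ℝ × ℝ → ℝ} (hw : ContDiff ℝ 1 w) {x : ℝ}
    (hx : x ∈ Set.Icc (0 : ℝ) 1) (y : ℝ) :
    |w (x, y)| ≤ ∫ s in (0 : ℝ)..1, (|w (s, y)| + |pd (1, 0) w (s, y)|) :=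
  abs_le_integral_abs_add_abs_deriv (fun s => hasDerivAt_fst hw s y)
    ((continuous_pd hw _).comp (by fun_prop)) hx

lemma abs_le_integral_snd {w : ℝ × ℝ → ℝ} (hw : ContDiff ℝ 1 w) {y : ℝ}
    (hy : y ∈ Set.Icc (0 : ℝ) 1) (x : ℝ) :
    |w (x, y)| ≤ ∫ t in (0 : ℝ)..1, (|w (x, t)| + |pd (0, 1) w (x, t)|) :=
  abs_le_integral_abs_add_abs_deriv (fun s => hasDerivAt_snd hw x s)
    ((continuous_pd hw _).comp (by fun_prop)) hy

lemma mem_unitSquare {p : ℝ × ℝ} :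
    p ∈ Set.Icc (0 : ℝ × ℝ) 1 ↔ p.1 ∈ Set.Icc (0 : ℝ) 1 ∧ p.2 ∈ Set.Icc (0 : ℝ) 1 := by
  rw [unitSquare_eq_prod, Set.mem_prod]

lemma abs_le_integral_mixed {w : ℝ × ℝ → ℝ} (hw : ContDiff ℝ 2 w) {p : ℝ × ℝ}
    (hp : p ∈ Set.Icc (0 : ℝ × ℝ) 1) :
    |w p| ≤ ∫ q in Set.Icc (0 : ℝ × ℝ) 1, ((|w q| + |pd (0, 1) w q|) +
      (|pd (1, 0) w q| + |pd (0, 1) (pd (1, 0) w) q|)) := by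
  have hw1 : ContDiff ℝ 1 w := hw.of_le (by norm_num)
  have c0 := hw.continuous
  have c1 := continuous_pd hw1 (1, 0)
  have c2 := continuous_pd hw1 (0, 1)
  have c3 := continuous_pd (contDiff_pd hw (1, 0)) (0, 1)
  obtain ⟨h1, h2⟩ := mem_unitSquare.1 hp
  rw [integral_unitSquare (by fun_prop)]
  refine (abs_le_integral_fst hw1 h1 p.2).trans ?_
  refine intervalIntegral.integral_mono_on zero_le_one
    (Continuous.intervalIntegrable (by fun_prop) _ _)
    (Continuous.intervalIntegrable
      (intervalIntegral.continuous_parametric_intervalIntegral_of_continuous' (by fun_prop) _ _)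
      _ _) fun s _ => ?_
  rw [intervalIntegral.integral_add (Continuous.intervalIntegrable (by fun_prop) _ _)
    (Continuous.intervalIntegrable (by fun_prop) _ _)]
  exact add_le_add (abs_le_integral_snd hw1 h2 s)
    (abs_le_integral_snd (contDiff_pd hw (1, 0)) h2 s)

lemma integral_sq_le_mul {w : ℝ × ℝ → ℝ} (hw : ContDiff ℝ 1 w) :
    ∫ p in Set.Icc (0 : ℝ × ℝ) 1, w p ^ 2 ≤
      (∫ p in Set.Icc (0 : ℝ × ℝ) 1, (|w p| + |pd (1, 0) w p|)) *
      ∫ p in Set.Icc (0 : ℝ × ℝ) 1, (|w p| + |pd (0, 1) w p|) := by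
  have c0 := hw.continuous
  have c1 := continuous_pd hw (1, 0)
  have c2 := continuous_pd hw (0, 1)
  set G : ℝ → ℝ := fun y => ∫ s in (0 : ℝ)..1, (|w (s, y)| + |pd (1, 0) w (s, y)|) with hG
  set H : ℝ → ℝ := fun x => ∫ t in (0 : ℝ)..1, (|w (x, t)| + |pd (0, 1) w (x, t)|) with hH
  have cG : Continuous G :=
    intervalIntegral.continuous_parametric_intervalIntegral_of_continuous' (by fun_prop) _ _
  have cH : Continuous H :=
    intervalIntegral.continuous_parametric_intervalIntegral_of_continuous' (by fun_prop) _ _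
  have hle : ∫ p in Set.Icc (0 : ℝ × ℝ) 1, w p ^ 2 ≤
      ∫ p in Set.Icc (0 : ℝ × ℝ) 1, H p.1 * G p.2 := by
    refine setIntegral_mono_on (integrableOn_unitSquare (by fun_prop))
      (integrableOn_unitSquare (by fun_prop)) measurableSet_Icc fun p hp => ?_
    obtain ⟨h1, h2⟩ := mem_unitSquare.1 hp
    have hg := abs_le_integral_fst hw h1 p.2
    have hh := abs_le_integral_snd hw h2 p.1
    rw [← sq_abs, sq]
    exact mul_le_mul hh hg (abs_nonneg _) ((abs_nonneg _).trans hh)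
  refine hle.trans_eq ?_
  rw [integral_unitSquare (by fun_prop), integral_unitSquare_swap (by fun_prop),
    integral_unitSquare (f := fun p => |w p| + |pd (0, 1) w p|) (by fun_prop)]
  simp only [intervalIntegral.integral_const_mul, intervalIntegral.integral_mul_const]
  rw [mul_comm]

lemma pd_pow {u : ℝ × ℝ → ℝ} (hu : ContDiff ℝ 1 u) (m : ℕ) (e p : ℝ × ℝ) :
    pd e (fun q => u q ^ m) p = m * u p ^ (m - 1) * pd e u p := by
  have := ((hu.differentiable one_ne_zero) p).hasFDerivAt.pow m
  simp [pd, this.fderiv]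

lemma pd_mul {f g : ℝ × ℝ → ℝ} (hf : ContDiff ℝ 1 f) (hg : ContDiff ℝ 1 g) (e p : ℝ × ℝ) :
    pd e (fun q => f q * g q) p = f p * pd e g p + g p * pd e f p := by
  have := ((hf.differentiable one_ne_zero) p).hasFDerivAt.mul
    ((hg.differentiable one_ne_zero) p).hasFDerivAt
  change fderiv ℝ (f * g) p e = _
  simp [pd, this.fderiv]

lemma pd_pd_pow {u : ℝ × ℝ → ℝ} (hu : ContDiff ℝ 2 u) (n : ℕ) (e e' p : ℝ × ℝ) :
    pd e' (pd e fun q => u q ^ (n + 2)) p =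
      (n + 2) * (n + 1) * u p ^ n * (pd e' u p * pd e u p)
        + (n + 2) * u p ^ (n + 1) * pd e' (pd e u) p := by
  have hu1 : ContDiff ℝ 1 u := hu.of_le (by norm_num)
  have h : pd e (fun q => u q ^ (n + 2)) = fun q => u q ^ (n + 1) * ((n + 2) * pd e u q) := by
    funext q
    rw [pd_pow hu1]
    rw [show n + 2 - 1 = n + 1 from rfl]
    push_cast
    ring
  rw [h, pd_mul (hu1.pow _) (contDiff_const.mul (contDiff_pd hu e)), pd_pow hu1,
    pd_mul contDiff_const (contDiff_pd hu e)]
  simp [pd]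
  ring

/-- The `L²` norm of the gradient over the unit square. -/
noncomputable def l2NormGrad (v : ℝ × ℝ → ℝ) : ℝ :=
  √(∫ x in Set.Icc (0 : ℝ × ℝ) 1, ((pd (1, 0) v x) ^ 2 + (pd (0, 1) v x) ^ 2))

/-- The `L²` norm of the Hessian over the unit square. -/
noncomputable def l2NormHess (v : ℝ × ℝ → ℝ) : ℝ :=
  √(∫ x in Set.Icc (0 : ℝ × ℝ) 1,
    ((pd (1, 0) (pd (1, 0) v) x) ^ 2 + (pd (1, 0) (pd (0, 1) v) x) ^ 2 +
     (pd (0, 1) (pd (1, 0) v) x) ^ 2 + (pd (0, 1) (pd (0, 1) v) x) ^ 2))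

lemma l2NormGrad_nonneg (v : ℝ × ℝ → ℝ) : 0 ≤ l2NormGrad v := Real.sqrt_nonneg _

lemma l2NormHess_nonneg (v : ℝ × ℝ → ℝ) : 0 ≤ l2NormHess v := Real.sqrt_nonneg _

lemma l2NormGrad_sq {v : ℝ × ℝ → ℝ} (hv : ContDiff ℝ 1 v) :
    l2NormGrad v ^ 2 = l2Norm (pd (1, 0) v) ^ 2 + l2Norm (pd (0, 1) v) ^ 2 := by
  have c1 := continuous_pd hv (1, 0)
  have c2 := continuous_pd hv (0, 1)
  rw [l2NormGrad, Real.sq_sqrt (integral_nonneg fun _ => by positivity), l2Norm_sq, l2Norm_sq,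
    integral_add (integrableOn_unitSquare (by fun_prop)) (integrableOn_unitSquare (by fun_prop))]

lemma l2NormHess_sq {v : ℝ × ℝ → ℝ} (hv : ContDiff ℝ 2 v) :
    l2NormHess v ^ 2 = l2Norm (pd (1, 0) (pd (1, 0) v)) ^ 2 + l2Norm (pd (1, 0) (pd (0, 1) v)) ^ 2
      + l2Norm (pd (0, 1) (pd (1, 0) v)) ^ 2 + l2Norm (pd (0, 1) (pd (0, 1) v)) ^ 2 := by
  have c (e e' : ℝ × ℝ) := continuous_pd (contDiff_pd hv e) e'
  have i (e e' : ℝ × ℝ) : IntegrableOn (fun x => pd e' (pd e v) x ^ 2)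
      (Set.Icc (0 : ℝ × ℝ) 1) := integrableOn_unitSquare ((c e e').pow 2)
  rw [l2NormHess, Real.sq_sqrt (integral_nonneg fun _ => by positivity)]
  simp only [l2Norm_sq]
  rw [integral_add _ (i _ _), integral_add _ (i _ _), integral_add (i _ _) (i _ _)]
  · exact (i _ _).add (i _ _)
  · exact ((i _ _).add (i _ _)).add (i _ _)

lemma l2Norm_fst_le_grad {v : ℝ × ℝ → ℝ} (hv : ContDiff ℝ 1 v) :
    l2Norm (pd (1, 0) v) ≤ l2NormGrad v := by
  refine abs_le_of_sq_le_sq' ?_ (l2NormGrad_nonneg v) |>.2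
  rw [l2NormGrad_sq hv]
  linarith [sq_nonneg (l2Norm (pd (0, 1) v))]

lemma l2Norm_snd_le_grad {v : ℝ × ℝ → ℝ} (hv : ContDiff ℝ 1 v) :
    l2Norm (pd (0, 1) v) ≤ l2NormGrad v := by
  refine abs_le_of_sq_le_sq' ?_ (l2NormGrad_nonneg v) |>.2
  rw [l2NormGrad_sq hv]
  linarith [sq_nonneg (l2Norm (pd (1, 0) v))]

lemma l2Norm_pd_pd_le_hess {v : ℝ × ℝ → ℝ} (hv : ContDiff ℝ 2 v) :
    l2Norm (pd (1, 0) (pd (1, 0) v)) ≤ l2NormHess v ∧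
    l2Norm (pd (0, 1) (pd (1, 0) v)) ≤ l2NormHess v ∧
    l2Norm (pd (0, 1) (pd (0, 1) v)) ≤ l2NormHess v := by
  have h := l2NormHess_sq hv
  refine ⟨abs_le_of_sq_le_sq' ?_ (l2NormHess_nonneg v) |>.2,
    abs_le_of_sq_le_sq' ?_ (l2NormHess_nonneg v) |>.2,
    abs_le_of_sq_le_sq' ?_ (l2NormHess_nonneg v) |>.2⟩ <;> rw [h]
  all_goals
    nlinarith [sq_nonneg (l2Norm (pd (1, 0) (pd (1, 0) v))),
      sq_nonneg (l2Norm (pd (0, 1) (pd (1, 0) v))), sq_nonneg (l2Norm (pd (0, 1) (pd (0, 1) v))),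
      sq_nonneg (l2Norm (pd (1, 0) (pd (0, 1) v)))]

lemma l2Norm_pow_succ_le {u : ℝ × ℝ → ℝ} (hu : ContDiff ℝ 1 u) (m : ℕ) :
    l2Norm (fun p => u p ^ (m + 1)) ≤
      (l2Norm u + (m + 1) * l2NormGrad u) * l2Norm fun p => u p ^ m := by
  have c0 := hu.continuous
  have key (e : ℝ × ℝ) (he : l2Norm (pd e u) ≤ l2NormGrad u) :
      ∫ p in Set.Icc (0 : ℝ × ℝ) 1, (|u p ^ (m + 1)| + |pd e (fun q => u q ^ (m + 1)) p|) ≤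
      (l2Norm u + (m + 1) * l2NormGrad u) * l2Norm fun p => u p ^ m := by
    have c1 := continuous_pd hu e
    have hpt : (fun p => |u p ^ (m + 1)| + |pd e (fun q => u q ^ (m + 1)) p|) =
        fun p => |u p ^ m * u p| + (m + 1) * |u p ^ m * pd e u p| := by
      funext p
      rw [pd_pow hu, pow_succ, Nat.add_sub_cancel, mul_assoc, abs_mul (((m + 1 : ℕ) : ℝ)),
        Nat.abs_cast]
      push_cast
      rfl
    rw [hpt, integral_add (integrableOn_unitSquare (by fun_prop))
      (integrableOn_unitSquare (by fun_prop)), integral_const_mul]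
    have cm : Continuous fun p => u p ^ m := c0.pow m
    have h1 := integral_abs_mul_le cm c0
    have h2 := integral_abs_mul_le cm c1
    have h3 := h2.trans (mul_le_mul_of_nonneg_left he (l2Norm_nonneg _))
    have h4 := mul_le_mul_of_nonneg_left h3 (by positivity : (0 : ℝ) ≤ m + 1)
    linarith
  refine abs_le_of_sq_le_sq' ?_ (mul_nonneg (add_nonneg (l2Norm_nonneg _)
    (mul_nonneg (by positivity) (l2NormGrad_nonneg u))) (l2Norm_nonneg _)) |>.2
  rw [l2Norm_sq, sq (_ * _)]
  refine (integral_sq_le_mul (hu.pow (m + 1))).trans ?_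
  have h0 : 0 ≤ ∫ p in Set.Icc (0 : ℝ × ℝ) 1,
      (|u p ^ (m + 1)| + |pd (0, 1) (fun q => u q ^ (m + 1)) p|) :=
    integral_nonneg fun _ => by positivity
  have h1 := key (1, 0) (l2Norm_fst_le_grad hu)
  have h2 := key (0, 1) (l2Norm_snd_le_grad hu)
  exact mul_le_mul h1 h2 h0 (h0.trans h2)

lemma exists_l2Norm_pow_le (n : ℕ) : ∃ K : ℝ, 0 ≤ K ∧ ∀ u : ℝ × ℝ → ℝ, ContDiff ℝ 1 u →
    l2Norm u ≤ 2 * l2NormGrad u →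
    l2Norm (fun p => u p ^ (n + 1)) ≤ K * l2NormGrad u ^ n * l2Norm u := by
  induction n with
  | zero => exact ⟨1, zero_le_one, fun u _ _ => by simp⟩
  | succ n ih =>
    obtain ⟨K, hK, ih⟩ := ih
    refine ⟨(n + 4) * K, by positivity, fun u hu hAB => ?_⟩
    refine (l2Norm_pow_succ_le hu (n + 1)).trans ?_
    have hB := l2NormGrad_nonneg u
    have hA := l2Norm_nonneg u
    push_cast
    calc _ ≤ ((n + 4) * l2NormGrad u) * (K * l2NormGrad u ^ n * l2Norm u) :=
          mul_le_mul (by linarith) (ih u hu hAB) (l2Norm_nonneg _) (by positivity)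
      _ = _ := by ring

lemma pd_sub_const (v : ℝ × ℝ → ℝ) (c : ℝ) (e : ℝ × ℝ) : pd e (fun p => v p - c) = pd e v := by
  funext p
  simp [pd, fderiv_sub_const]

lemma l2NormGrad_sub_const (v : ℝ × ℝ → ℝ) (c : ℝ) :
    l2NormGrad (fun p => v p - c) = l2NormGrad v := by
  simp only [l2NormGrad, pd_sub_const]

lemma l2NormHess_sub_const (v : ℝ × ℝ → ℝ) (c : ℝ) :
    l2NormHess (fun p => v p - c) = l2NormHess v := by
  simp only [l2NormHess, pd_sub_const]

lemma integral_unitSquare_const (c : ℝ) : ∫ _ in Set.Icc (0 : ℝ × ℝ) 1, c = c := by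
  rw [setIntegral_const, volume_unitSquare, one_smul]

lemma l2Norm_sub_mean_sq {v : ℝ × ℝ → ℝ} (hv : Continuous v) :
    l2Norm (fun p => v p - ∫ q in Set.Icc (0 : ℝ × ℝ) 1, v q) ^ 2
      + (∫ q in Set.Icc (0 : ℝ × ℝ) 1, v q) ^ 2 = l2Norm v ^ 2 := by
  rw [l2Norm_sq, l2Norm_sq]
  set c := ∫ q in Set.Icc (0 : ℝ × ℝ) 1, v q with hc
  have h : (fun p => (v p - c) ^ 2) = fun p => v p ^ 2 - (2 * c * v p - c ^ 2) := by
    funext p; ring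
  rw [h, integral_sub (integrableOn_unitSquare (by fun_prop))
    (integrableOn_unitSquare (by fun_prop)), integral_sub (integrableOn_unitSquare (by fun_prop))
    (integrableOn_unitSquare (by fun_prop)), integral_const_mul, integral_unitSquare_const, ← hc]
  ring

lemma integral_abs_sq_le {g : ℝ → ℝ} (hg : Continuous g) :
    (∫ s in (0 : ℝ)..1, |g s|) ^ 2 ≤ ∫ s in (0 : ℝ)..1, g s ^ 2 := by
  have i {h : ℝ → ℝ} (hh : Continuous h) : IntegrableOn h (Set.Ioc 0 1) :=
    (intervalIntegrable_iff_integrableOn_Ioc_of_le zero_le_one).1 (hh.intervalIntegrable _ _)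
  simp only [intervalIntegral.integral_of_le zero_le_one]
  have := sq_integral_mul_le (μ := volume.restrict (Set.Ioc (0 : ℝ) 1)) (f := fun s => |g s|)
    (g := fun _ => 1) (i (by fun_prop)) (i (by fun_prop)) (i (by fun_prop))
  simpa using this

lemma abs_sub_mean_le {v : ℝ × ℝ → ℝ} (hv : ContDiff ℝ 1 v) {p : ℝ × ℝ}
    (hp : p ∈ Set.Icc (0 : ℝ × ℝ) 1) :
    |v p - ∫ q in Set.Icc (0 : ℝ × ℝ) 1, v q| ≤
      (∫ s in (0 : ℝ)..1, |pd (1, 0) v (s, p.2)|)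
        + ∫ q in Set.Icc (0 : ℝ × ℝ) 1, |pd (0, 1) v q| := by
  have c0 := hv.continuous
  have c1 := continuous_pd hv (1, 0)
  have c2 := continuous_pd hv (0, 1)
  obtain ⟨h1, h2⟩ := mem_unitSquare.1 hp
  set a := ∫ s in (0 : ℝ)..1, |pd (1, 0) v (s, p.2)|
  set b : ℝ → ℝ := fun x => ∫ t in (0 : ℝ)..1, |pd (0, 1) v (x, t)| with hb
  have cb : Continuous b :=
    intervalIntegral.continuous_parametric_intervalIntegral_of_continuous' (by fun_prop) _ _
  calc _ = |∫ q in Set.Icc (0 : ℝ × ℝ) 1, (v p - v q)| := by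
        rw [integral_sub (integrableOn_unitSquare (by fun_prop))
          (integrableOn_unitSquare c0), integral_unitSquare_const]
    _ ≤ ∫ q in Set.Icc (0 : ℝ × ℝ) 1, |v p - v q| := abs_integral_le_integral_abs
    _ ≤ ∫ q in Set.Icc (0 : ℝ × ℝ) 1, (a + b q.1) := by
        refine setIntegral_mono_on (integrableOn_unitSquare (by fun_prop))
          (integrableOn_unitSquare (by fun_prop)) measurableSet_Icc fun q hq => ?_
        obtain ⟨h3, h4⟩ := mem_unitSquare.1 hq
        refine (abs_sub_le (v p) (v (q.1, p.2)) (v q)).trans (add_le_add ?_ ?_)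
        · exact abs_sub_le_integral_abs_deriv (fun s => hasDerivAt_fst hv s p.2)
            (c1.comp (by fun_prop)) h1 h3
        · exact abs_sub_le_integral_abs_deriv (fun s => hasDerivAt_snd hv q.1 s)
            (c2.comp (by fun_prop)) h2 h4
    _ = _ := by
        rw [integral_add (integrableOn_unitSquare (by fun_prop))
          (integrableOn_unitSquare (by fun_prop)), integral_unitSquare_const,
          integral_unitSquare (by fun_prop), integral_unitSquare (by fun_prop)]
        simp [hb]

lemma l2Norm_sub_mean_le {v : ℝ × ℝ → ℝ} (hv : ContDiff ℝ 1 v) :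
    l2Norm (fun p => v p - ∫ q in Set.Icc (0 : ℝ × ℝ) 1, v q) ≤ 2 * l2NormGrad v := by
  have c0 := hv.continuous
  have c1 := continuous_pd hv (1, 0)
  have c2 := continuous_pd hv (0, 1)
  refine abs_le_of_sq_le_sq' ?_ (mul_nonneg zero_le_two (l2NormGrad_nonneg v)) |>.2
  rw [mul_pow, l2NormGrad_sq hv, l2Norm_sq, l2Norm_sq, l2Norm_sq]
  set b := ∫ q in Set.Icc (0 : ℝ × ℝ) 1, |pd (0, 1) v q| with hb
  have hb2 : b ^ 2 ≤ ∫ q in Set.Icc (0 : ℝ × ℝ) 1, pd (0, 1) v q ^ 2 := by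
    have := sq_integral_mul_le (μ := volume.restrict (Set.Icc (0 : ℝ × ℝ) 1))
      (f := fun q => |pd (0, 1) v q|) (g := fun _ => 1) (integrableOn_unitSquare (by fun_prop))
      (integrableOn_unitSquare (by fun_prop)) (integrableOn_unitSquare (by fun_prop))
    simpa [volume_unitSquare] using this
  set a : ℝ → ℝ := fun y => ∫ s in (0 : ℝ)..1, pd (1, 0) v (s, y) ^ 2 with ha
  have ca : Continuous a :=
    intervalIntegral.continuous_parametric_intervalIntegral_of_continuous' (by fun_prop) _ _
  have h : ∫ p in Set.Icc (0 : ℝ × ℝ) 1, (v p - ∫ q in Set.Icc (0 : ℝ × ℝ) 1, v q) ^ 2 ≤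
      ∫ p in Set.Icc (0 : ℝ × ℝ) 1, (2 * a p.2 + 2 * b ^ 2) := by
    refine setIntegral_mono_on (integrableOn_unitSquare (by fun_prop))
      (integrableOn_unitSquare (by fun_prop)) measurableSet_Icc fun p hp => ?_
    have h1 := abs_sub_mean_le hv hp
    have h2 : _ ≤ a p.2 := integral_abs_sq_le (g := fun s => pd (1, 0) v (s, p.2)) (by fun_prop)
    rw [← sq_abs]
    have h3 := pow_le_pow_left₀ (abs_nonneg _) h1 2
    have h4 := add_sq_le (a := ∫ s in (0 : ℝ)..1, |pd (1, 0) v (s, p.2)|) (b := b)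
    linarith
  rw [integral_add (integrableOn_unitSquare (by fun_prop))
    (integrableOn_unitSquare (by fun_prop)), integral_unitSquare_const, integral_const_mul,
    integral_unitSquare_swap (f := fun p => a p.2) (by fun_prop)] at h
  rw [integral_unitSquare_swap (f := fun p => pd (1, 0) v p ^ 2) (by fun_prop)]
  have h0 : 0 ≤ ∫ y in (0 : ℝ)..1, a y := intervalIntegral.integral_nonneg zero_le_one
    fun y _ => intervalIntegral.integral_nonneg zero_le_one fun _ _ => sq_nonneg _
  simp only [intervalIntegral.integral_const, sub_zero, one_smul] at h
  linarith [sq_nonneg b]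

lemma pd_periodic {v : ℝ × ℝ → ℝ} {h : ℝ × ℝ} (hv : ∀ x, v (x + h) = v x) (e x : ℝ × ℝ) :
    pd e v (x + h) = pd e v x := by
  simp only [pd]
  rw [← fderiv_comp_add_right, funext hv]

lemma integral_deriv_sq_eq {f f' f'' : ℝ → ℝ} (hf : ∀ x, HasDerivAt f (f' x) x)
    (hf' : ∀ x, HasDerivAt f' (f'' x) x) (hc : Continuous f'') (h0 : f 1 = f 0)
    (h1 : f' 1 = f' 0) :
    ∫ s in (0 : ℝ)..1, f' s ^ 2 = ∫ s in (0 : ℝ)..1, -(f s * f'' s) := by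
  have c1 : Continuous f' := continuous_iff_continuousAt.2 fun x => (hf' x).continuousAt
  have := intervalIntegral.integral_mul_deriv_eq_deriv_mul (fun x _ => hf x) (fun x _ => hf' x)
    (c1.intervalIntegrable 0 1) (hc.intervalIntegrable 0 1)
  rw [intervalIntegral.integral_neg, this, h0, h1]
  simp [sq]

lemma l2NormGrad_sq_le {v : ℝ × ℝ → ℝ} (hv : ContDiff ℝ 2 v)
    (hx : ∀ x : ℝ × ℝ, v (x + (1, 0)) = v x) (hy : ∀ x : ℝ × ℝ, v (x + (0, 1)) = v x) :
    l2NormGrad v ^ 2 ≤ 2 * (l2Norm v * l2NormHess v) := by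
  have hv1 : ContDiff ℝ 1 v := hv.of_le (by norm_num)
  have c0 := hv.continuous
  have c1 := continuous_pd hv1 (1, 0)
  have c2 := continuous_pd hv1 (0, 1)
  have c3 := continuous_pd (contDiff_pd hv (1, 0)) (1, 0)
  have c4 := continuous_pd (contDiff_pd hv (0, 1)) (0, 1)
  have bound {g : ℝ × ℝ → ℝ} (cg : Continuous g) (hg : l2Norm g ≤ l2NormHess v) :
      ∫ p in Set.Icc (0 : ℝ × ℝ) 1, -(v p * g p) ≤ l2Norm v * l2NormHess v := by
    refine le_trans ?_ ((integral_abs_mul_le c0 cg).trans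
      (mul_le_mul_of_nonneg_left hg (l2Norm_nonneg v)))
    exact integral_mono (integrableOn_unitSquare (by fun_prop))
      (integrableOn_unitSquare (by fun_prop)) fun p => neg_le_abs _
  have e1 : ∫ p in Set.Icc (0 : ℝ × ℝ) 1, pd (1, 0) v p ^ 2 =
      ∫ p in Set.Icc (0 : ℝ × ℝ) 1, -(v p * pd (1, 0) (pd (1, 0) v) p) := by
    rw [integral_unitSquare_swap (by fun_prop), integral_unitSquare_swap (by fun_prop)]
    congr 1
    funext y
    refine integral_deriv_sq_eq (fun x => hasDerivAt_fst hv1 x y)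
      (fun x => hasDerivAt_fst (contDiff_pd hv _) x y) (c3.comp (by fun_prop)) ?_ ?_
    · simpa using hx (0, y)
    · simpa using pd_periodic hx (1, 0) (0, y)
  have e2 : ∫ p in Set.Icc (0 : ℝ × ℝ) 1, pd (0, 1) v p ^ 2 =
      ∫ p in Set.Icc (0 : ℝ × ℝ) 1, -(v p * pd (0, 1) (pd (0, 1) v) p) := by
    rw [integral_unitSquare (by fun_prop), integral_unitSquare (by fun_prop)]
    congr 1
    funext x
    refine integral_deriv_sq_eq (fun y => hasDerivAt_snd hv1 x y)
      (fun y => hasDerivAt_snd (contDiff_pd hv _) x y) (c4.comp (by fun_prop)) ?_ ?_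
    · simpa using hy (x, 0)
    · simpa using pd_periodic hy (0, 1) (x, 0)
  obtain ⟨b1, -, b2⟩ := l2Norm_pd_pd_le_hess hv
  rw [l2NormGrad_sq hv1, l2Norm_sq, l2Norm_sq, e1, e2]
  linarith [bound c3 b1, bound c4 b2]

lemma exists_pow_le_add (n : ℕ) : ∃ K : ℝ, 0 ≤ K ∧ ∀ u : ℝ × ℝ → ℝ, ContDiff ℝ 2 u →
    l2Norm u ≤ 2 * l2NormGrad u → l2NormGrad u ^ 2 ≤ 2 * (l2Norm u * l2NormHess u) →
    ∀ M : ℝ, (∀ p ∈ Set.Icc (0 : ℝ × ℝ) 1, |u p| ≤ M) → ∀ p ∈ Set.Icc (0 : ℝ × ℝ) 1,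
    |u p| ^ (n + 2) ≤ K * (l2NormGrad u ^ n * (l2Norm u * l2NormHess u))
      + (n + 2) ^ 2 * (M ^ n * l2NormGrad u ^ 2) := by
  obtain ⟨K, hK, hKu⟩ := exists_l2Norm_pow_le n
  refine ⟨(9 * n + 26) * K, by positivity, fun u hu hAB hBD M hM p hp => ?_⟩
  have hu1 : ContDiff ℝ 1 u := hu.of_le (by norm_num)
  have c0 := hu.continuous
  have cn : Continuous fun p => u p ^ (n + 1) := c0.pow _
  have c1 := continuous_pd hu1 (1, 0)
  have c2 := continuous_pd hu1 (0, 1)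
  have c3 := continuous_pd (contDiff_pd hu (1, 0)) (0, 1)
  have hM0 : 0 ≤ M := (abs_nonneg _).trans (hM p hp)
  have hN := hKu u hu1 hAB
  set A := l2Norm u
  set B := l2NormGrad u
  set D := l2NormHess u
  set N := l2Norm fun p => u p ^ (n + 1)
  have hA : 0 ≤ A := l2Norm_nonneg _
  have hB : 0 ≤ B := l2NormGrad_nonneg _
  have hD : 0 ≤ D := l2NormHess_nonneg _
  have hN0 : 0 ≤ N := l2Norm_nonneg _
  have hx : l2Norm (pd (1, 0) u) ≤ B := l2Norm_fst_le_grad hu1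
  have hy : l2Norm (pd (0, 1) u) ≤ B := l2Norm_snd_le_grad hu1
  have hxy : l2Norm (pd (0, 1) (pd (1, 0) u)) ≤ D := (l2Norm_pd_pd_le_hess hu).2.1
  have b0 := integral_abs_mul_le cn c0
  have b1 := (integral_abs_mul_le cn c1).trans (mul_le_mul_of_nonneg_left hx hN0)
  have b2 := (integral_abs_mul_le cn c2).trans (mul_le_mul_of_nonneg_left hy hN0)
  have b3 := (integral_abs_mul_le cn c3).trans (mul_le_mul_of_nonneg_left hxy hN0)
  have b4 := (integral_abs_mul_le c2 c1).trans (mul_le_mul hy hx (l2Norm_nonneg _) hB)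
  have hpd (e q : ℝ × ℝ) : |pd e (fun q => u q ^ (n + 2)) q| =
      (n + 2) * |u q ^ (n + 1) * pd e u q| := by
    rw [pd_pow hu1, show n + 2 - 1 = n + 1 from rfl, mul_assoc, abs_mul ((n + 2 : ℕ) : ℝ),
      Nat.abs_cast]
    push_cast
    rfl
  have hle : |u p ^ (n + 2)| ≤ ∫ q in Set.Icc (0 : ℝ × ℝ) 1,
      ((|u q ^ (n + 1) * u q| + (n + 2) * |u q ^ (n + 1) * pd (0, 1) u q|) +
      ((n + 2) * |u q ^ (n + 1) * pd (1, 0) u q| +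
        ((n + 2) * (n + 1) * M ^ n * |pd (0, 1) u q * pd (1, 0) u q| +
          (n + 2) * |u q ^ (n + 1) * pd (0, 1) (pd (1, 0) u) q|))) := by
    have hw : ContDiff ℝ 2 fun q => u q ^ (n + 2) := hu.pow _
    have d0 := hw.continuous
    have d1 := continuous_pd (hu1.pow (n + 2)) (1, 0)
    have d2 := continuous_pd (hu1.pow (n + 2)) (0, 1)
    have d3 := continuous_pd (contDiff_pd hw (1, 0)) (0, 1)
    refine (abs_le_integral_mixed hw hp).trans
      (setIntegral_mono_on (integrableOn_unitSquare (by fun_prop))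
        (integrableOn_unitSquare (by fun_prop)) measurableSet_Icc fun q hq => ?_)
    rw [hpd, hpd, pd_pd_pow hu]
    have e0 : |u q ^ (n + 2)| = |u q ^ (n + 1) * u q| := by rw [← pow_succ]
    rw [e0]
    gcongr
    refine (abs_add_le _ _).trans (add_le_add ?_ (le_of_eq ?_))
    · rw [abs_mul, abs_mul, abs_of_nonneg (by positivity : (0 : ℝ) ≤ (n + 2) * (n + 1)), abs_pow]
      gcongr
      exact hM q hq
    · rw [mul_assoc, abs_mul, abs_of_nonneg (by positivity : (0 : ℝ) ≤ n + 2)]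
  rw [abs_pow] at hle
  rw [integral_add, integral_add, integral_add, integral_add] at hle
  rotate_left
  iterate 8 exact integrableOn_unitSquare (by fun_prop)
  simp only [integral_const_mul] at hle
  have hND : N * D ≤ K * (B ^ n * (A * D)) := by
    calc N * D ≤ (K * B ^ n * A) * D := by gcongr
      _ = _ := by ring
  have hNB : N * B ≤ 4 * K * (B ^ n * (A * D)) := by
    calc N * B ≤ (K * B ^ n * A) * B := by gcongr
      _ ≤ (K * B ^ n * (2 * B)) * B := by gcongr
      _ = 2 * K * B ^ n * B ^ 2 := by ring
      _ ≤ 2 * K * B ^ n * (2 * (A * D)) := by gcongr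
      _ = _ := by ring
  have hNA : N * A ≤ 2 * (N * B) := by
    calc N * A ≤ N * (2 * B) := by gcongr
      _ = _ := by ring
  have hn : (0 : ℝ) ≤ n + 2 := by positivity
  have f1 := mul_le_mul_of_nonneg_left (b1.trans hNB) hn
  have f2 := mul_le_mul_of_nonneg_left (b2.trans hNB) hn
  have f3 := mul_le_mul_of_nonneg_left (b3.trans hND) hn
  have f4 := mul_le_mul_of_nonneg_left b4
    (by positivity : (0 : ℝ) ≤ (n + 2) * (n + 1) * M ^ n)
  have f5 : 0 ≤ (n + 2) * (M ^ n * B ^ 2) := by positivity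
  have hX : 0 ≤ K * (B ^ n * (A * D)) := by positivity
  have f0 := b0.trans (hNA.trans (mul_le_mul_of_nonneg_left hNB zero_le_two))
  linarith

lemma exists_pow_sup_le (n : ℕ) : ∃ K : ℝ, 0 < K ∧ ∀ u : ℝ × ℝ → ℝ, ContDiff ℝ 2 u →
    l2Norm u ≤ 2 * l2NormGrad u → l2NormGrad u ^ 2 ≤ 2 * (l2Norm u * l2NormHess u) →
    ∃ M : ℝ, 0 ≤ M ∧ (∀ p ∈ Set.Icc (0 : ℝ × ℝ) 1, |u p| ≤ M) ∧
    M ^ (n + 2) ≤ K * (l2NormGrad u ^ n * (2 * (l2Norm u * l2NormHess u))) := by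
  obtain ⟨K, hK, hKu⟩ := exists_pow_le_add n
  refine ⟨K + (2 * (n + 2)) ^ (n + 2), by positivity, fun u hu hAB hBD => ?_⟩
  obtain ⟨p, hp, hmax⟩ := isCompact_Icc.exists_isMaxOn
    (⟨0, by simp⟩ : (Set.Icc (0 : ℝ × ℝ) 1).Nonempty) hu.continuous.abs.continuousOn
  have hM : ∀ q ∈ Set.Icc (0 : ℝ × ℝ) 1, |u q| ≤ |u p| := fun q hq => hmax hq
  have hle := hKu u hu hAB hBD _ hM p hp
  refine ⟨|u p|, abs_nonneg _, hM, ?_⟩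
  have hA := l2Norm_nonneg u
  have hB := l2NormGrad_nonneg u
  have hD := l2NormHess_nonneg u
  set M := |u p|
  set A := l2Norm u
  set B := l2NormGrad u
  set D := l2NormHess u
  have hM0 : 0 ≤ M := abs_nonneg _
  have hX : 0 ≤ B ^ n * (A * D) := by positivity
  rcases le_total M (2 * (n + 2) * B) with h | h
  · calc M ^ (n + 2) ≤ (2 * (n + 2) * B) ^ (n + 2) := by gcongr
      _ = (2 * (n + 2)) ^ (n + 2) * (B ^ n * B ^ 2) := by rw [mul_pow, pow_add B]
      _ ≤ (2 * (n + 2)) ^ (n + 2) * (B ^ n * (2 * (A * D))) := by gcongr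
      _ ≤ _ := by
        gcongr
        linarith
  · have h2 : (2 * (n + 2) * B) ^ 2 ≤ M ^ 2 := by gcongr
    have h3 : M ^ n * (2 * (n + 2) * B) ^ 2 ≤ M ^ (n + 2) := by
      rw [pow_add]; gcongr
    have h4 : 0 ≤ (2 * ((n : ℝ) + 2)) ^ (n + 2) * (B ^ n * (A * D)) := by positivity
    have h5 : 0 ≤ M ^ (n + 2) := by positivity
    nlinarith

lemma sq_le_of_pow_le {γ M A B D K : ℝ} {n : ℕ} (hn : 2 ≤ γ * (n + 2))
    (hM : 0 ≤ M) (hA : 0 ≤ A) (hB : 0 ≤ B) (hD : 0 ≤ D) (hK : 0 ≤ K)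
    (hBD : B ^ 2 ≤ 2 * (A * D)) (h : M ^ (n + 2) ≤ K * (B ^ n * (2 * (A * D))))
    (hB0 : B = 0 → M = 0) :
    M ^ 2 ≤ K ^ (2 / ((n : ℝ) + 2)) * 2 ^ γ * (A ^ γ * B ^ (2 - 2 * γ) * D ^ γ) := by
  rcases hB.eq_or_lt with hB' | hB'
  · rw [hB0 hB'.symm]
    simp only [ne_eq, OfNat.ofNat_ne_zero, not_false_eq_true, zero_pow]
    positivity
  have hq : (0 : ℝ) < n + 2 := by positivity
  set R := 2 * (A * D) / B ^ 2 with hR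
  have hR1 : 1 ≤ R := by rwa [hR, one_le_div (by positivity)]
  have hrw : K * (B ^ n * (2 * (A * D))) = K * (B ^ (n + 2) * R) := by
    rw [hR, pow_add]; field_simp
  have hroot {x : ℝ} (hx : 0 ≤ x) : (x ^ (n + 2)) ^ (2 / ((n : ℝ) + 2)) = x ^ 2 := by
    rw [← Real.rpow_natCast, ← Real.rpow_mul hx, ← Real.rpow_natCast x 2]
    congr 1
    push_cast
    field_simp
  calc M ^ 2 = (M ^ (n + 2)) ^ (2 / ((n : ℝ) + 2)) := (hroot hM).symm
    _ ≤ (K * (B ^ (n + 2) * R)) ^ (2 / ((n : ℝ) + 2)) := by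
      rw [← hrw]
      exact Real.rpow_le_rpow (by positivity) h (by positivity)
    _ = K ^ (2 / ((n : ℝ) + 2)) * (B ^ 2 * R ^ (2 / ((n : ℝ) + 2))) := by
      rw [Real.mul_rpow hK (by positivity), Real.mul_rpow (by positivity) (by positivity),
        hroot hB]
    _ ≤ K ^ (2 / ((n : ℝ) + 2)) * (B ^ 2 * R ^ γ) := by
      gcongr
      rwa [div_le_iff₀ hq]
    _ = _ := by
      rw [hR, Real.div_rpow (by positivity) (by positivity), Real.mul_rpow zero_le_two
        (by positivity), Real.mul_rpow hA hD, Real.rpow_sub hB', Real.rpow_mul hB,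
        Real.rpow_two]
      ring

lemma exists_mem_unitSquare_eq {v : ℝ × ℝ → ℝ} (hx : ∀ x : ℝ × ℝ, v (x + (1, 0)) = v x)
    (hy : ∀ x : ℝ × ℝ, v (x + (0, 1)) = v x) (p : ℝ × ℝ) :
    ∃ q ∈ Set.Icc (0 : ℝ × ℝ) 1, v q = v p := by
  have px (y : ℝ) : Function.Periodic (fun s => v (s, y)) 1 := fun s => by simpa using hx (s, y)
  have py (x : ℝ) : Function.Periodic (fun t => v (x, t)) 1 := fun t => by simpa using hy (x, t)
  refine ⟨(Int.fract p.1, Int.fract p.2), mem_unitSquare.2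
    ⟨⟨Int.fract_nonneg _, (Int.fract_lt_one _).le⟩, ⟨Int.fract_nonneg _, (Int.fract_lt_one _).le⟩⟩,
    ?_⟩
  have h1 := (px (Int.fract p.2)).sub_int_mul_eq ⌊p.1⌋ (x := p.1)
  have h2 := (py p.1).sub_int_mul_eq ⌊p.2⌋ (x := p.2)
  simp only [mul_one, Int.self_sub_floor] at h1 h2
  exact h1.trans h2

/-- Gagliardo–Nirenberg-type inequality on the 2-torus: for every `0 < γ ≤ 1` there is a
constant `C = C(γ)` such that for all periodic `H²` (here `C²`) functions `v`,
`‖v‖_∞² ≤ C ‖v‖₂^γ ‖∇v‖₂^{2-2γ} ‖∇²v‖₂^γ + C ‖v‖₂²`. -/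
theorem gagliardo_nirenberg_sup (γ : ℝ) (hγ0 : 0 < γ) (hγ1 : γ ≤ 1) :
    ∃ C : ℝ, 0 < C ∧
      ∀ v : ℝ × ℝ → ℝ, ContDiff ℝ 2 v →
        (∀ x : ℝ × ℝ, v (x + (1, 0)) = v x) →
        (∀ x : ℝ × ℝ, v (x + (0, 1)) = v x) →
        (⨆ x : ℝ × ℝ, |v x|)^2
          ≤ C * (Real.sqrt (∫ x in Set.Icc (0 : ℝ × ℝ) 1, (v x)^2)) ^ γ
              * (Real.sqrt (∫ x in Set.Icc (0 : ℝ × ℝ) 1,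
                    ((pd (1,0) v x)^2 + (pd (0,1) v x)^2))) ^ (2 - 2*γ)
              * (Real.sqrt (∫ x in Set.Icc (0 : ℝ × ℝ) 1,
                    ((pd (1,0) (pd (1,0) v) x)^2 + (pd (1,0) (pd (0,1) v) x)^2 +
                     (pd (0,1) (pd (1,0) v) x)^2 + (pd (0,1) (pd (0,1) v) x)^2))) ^ γ
            + C * (Real.sqrt (∫ x in Set.Icc (0 : ℝ × ℝ) 1, (v x)^2))^2 := by
  obtain ⟨n, hn⟩ := exists_nat_ge (2 / γ)
  have hn2 : 2 ≤ γ * (n + 2) := by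
    rw [div_le_iff₀ hγ0] at hn
    linarith
  obtain ⟨K, hK, hKu⟩ := exists_pow_sup_le (n + 1)
  set c := K ^ (2 / (((n + 1 : ℕ) : ℝ) + 2)) * 2 ^ γ
  have hc : 0 < c := by positivity
  refine ⟨2 * c + 2, by positivity, fun v hv hx hy => ?_⟩
  change _ ≤ (2 * c + 2) * l2Norm v ^ γ * l2NormGrad v ^ (2 - 2 * γ) * l2NormHess v ^ γ
    + (2 * c + 2) * l2Norm v ^ 2
  have hv1 : ContDiff ℝ 1 v := hv.of_le (by norm_num)
  have hmean := l2Norm_sub_mean_sq hv.continuous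
  have hAB := l2Norm_sub_mean_le hv1
  set m := ∫ q in Set.Icc (0 : ℝ × ℝ) 1, v q
  have hu : ContDiff ℝ 2 fun p => v p - m := hv.sub contDiff_const
  have hBD := l2NormGrad_sq_le hu (by simpa using hx) (by simpa using hy)
  obtain ⟨M, hM, hMu, hMK⟩ := hKu _ hu (by rwa [l2NormGrad_sub_const]) hBD
  rw [l2NormGrad_sub_const, l2NormHess_sub_const] at hMK hBD
  have hA := l2Norm_nonneg fun p => v p - m
  have hB := l2NormGrad_nonneg v
  have hD := l2NormHess_nonneg v
  have hAv := l2Norm_nonneg v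
  set A := l2Norm fun p => v p - m
  set B := l2NormGrad v
  set D := l2NormHess v
  have hAA : A ≤ l2Norm v := abs_le_of_sq_le_sq' (by linarith [sq_nonneg m]) hAv |>.2
  have hB0 : B = 0 → M = 0 := fun h => by
    rw [h] at hMK
    exact pow_eq_zero_iff (by omega) |>.1 ((by simpa using hMK : M ^ (n + 1 + 2) ≤ 0).antisymm
      (by positivity))
  have hM2 := sq_le_of_pow_le (γ := γ) (by push_cast; linarith) hM hA hB hD hK.le hBD hMK hB0
  have hM3 : M ^ 2 ≤ c * (l2Norm v ^ γ * B ^ (2 - 2 * γ) * D ^ γ) := hM2.trans (by gcongr)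
  have hsup : ⨆ x : ℝ × ℝ, |v x| ≤ M + |m| := ciSup_le fun p => by
    obtain ⟨q, hq, hqp⟩ := exists_mem_unitSquare_eq hx hy p
    have h1 := hMu q hq
    have h2 := abs_sub_abs_le_abs_sub (v q) m
    rw [← hqp]
    linarith
  have hsup0 : 0 ≤ ⨆ x : ℝ × ℝ, |v x| := Real.iSup_nonneg fun _ => abs_nonneg _
  have hX : 0 ≤ l2Norm v ^ γ * B ^ (2 - 2 * γ) * D ^ γ := by positivity
  have hY : 0 ≤ c * l2Norm v ^ 2 := by positivity
  have h1 := pow_le_pow_left₀ hsup0 hsup 2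
  have h2 := add_sq_le (a := M) (b := |m|)
  rw [sq_abs] at h2
  linarith [sq_nonneg A]
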